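/- arXiv:2406.19161 — 5 statements merged into one kernel-verified Lean document; each statement's English description precedes it below -/
import Mathlib

section
/- Let A = max R, B₀ = min B, and s* = (A + B₀)/2. For all s₁, s₂ ∈ ℝ, if |s₁ − s*| ≤ |s₂ − s*| then M_max(s₁) ≤ M_max(s₂). Consequently, for any set S ⊆ ℝ of allowed separators, any element of S closest to s* minimizes M_max over S. -/
open scoped Classical

/-- `Mmax R B s` is the maximum distance from the separator `s` to a misclassified
point: `max (0, max {r - s : r ∈ R, r > s}, max {s - b : b ∈ B, b < s})`. -/
noncomputable def Mmax (R B : Finset ℝ) (s : ℝ) : ℝ :=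
  max ((R.filter (fun r => s < r)).fold max 0 (fun r => r - s))
      ((B.filter (fun b => b < s)).fold max 0 (fun b => s - b))

lemma Mmax_eq_max (R B : Finset ℝ) (hR : R.Nonempty) (hB : B.Nonempty) (s : ℝ) :
    Mmax R B s = max (max 0 (R.max' hR - s)) (max 0 (s - B.min' hB)) := by
  unfold Mmax
  congr 1
  · apply le_antisymm
    · refine (Finset.fold_max_le _).2 ⟨le_max_left _ _, fun r hr => le_max_of_le_right ?_⟩
      exact sub_le_sub_right (R.le_max' r (Finset.mem_filter.1 hr).1) s
    · refine max_le ((Finset.le_fold_max _).2 (Or.inl le_rfl)) ((Finset.le_fold_max _).2 ?_)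
      rcases le_or_gt (R.max' hR) s with h | h
      · exact Or.inl (sub_nonpos.2 h)
      · exact Or.inr ⟨_, Finset.mem_filter.2 ⟨R.max'_mem hR, h⟩, le_rfl⟩
  · apply le_antisymm
    · refine (Finset.fold_max_le _).2 ⟨le_max_left _ _, fun b hb => le_max_of_le_right ?_⟩
      exact sub_le_sub_left (B.min'_le b (Finset.mem_filter.1 hb).1) s
    · refine max_le ((Finset.le_fold_max _).2 (Or.inl le_rfl)) ((Finset.le_fold_max _).2 ?_)
      rcases le_or_gt s (B.min' hB) with h | h
      · exact Or.inl (sub_nonpos.2 h)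
      · exact Or.inr ⟨_, Finset.mem_filter.2 ⟨B.min'_mem hB, h⟩, le_rfl⟩

/-- The largest misclassification distance depends on `s` only through its distance to the
midpoint of the extreme points, and does so monotonically. -/
lemma Mmax_eq_abs_sub_midpoint (R B : Finset ℝ) (hR : R.Nonempty) (hB : B.Nonempty) (s : ℝ) :
    Mmax R B s =
      max 0 ((R.max' hR - B.min' hB) / 2 + |s - (R.max' hR + B.min' hB) / 2|) := by
  rw [Mmax_eq_max R B hR hB, max_max_max_comm, max_self, abs_eq_max_neg, ← max_add_add_left,
    max_comm (R.max' hR - s)]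
  congr 2 <;> ring

theorem stmt1 (R B : Finset ℝ) (hR : R.Nonempty) (hB : B.Nonempty) :
    let A := R.max' hR
    let B₀ := B.min' hB
    let sstar := (A + B₀) / 2
    (∀ s₁ s₂ : ℝ, |s₁ - sstar| ≤ |s₂ - sstar| → Mmax R B s₁ ≤ Mmax R B s₂) ∧
    (∀ S : Set ℝ, ∀ s₀ ∈ S, (∀ s ∈ S, |s₀ - sstar| ≤ |s - sstar|) →
      ∀ s ∈ S, Mmax R B s₀ ≤ Mmax R B s) := by
  intro A B₀ sstar
  have mono (s₁ s₂ : ℝ) (h : |s₁ - sstar| ≤ |s₂ - sstar|) : Mmax R B s₁ ≤ Mmax R B s₂ := by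
    rw [Mmax_eq_abs_sub_midpoint R B hR hB, Mmax_eq_abs_sub_midpoint R B hR hB]
    exact max_le_max le_rfl (add_le_add_right h _)
  exact ⟨mono, fun S s₀ _ hmin s hs => mono s₀ s (hmin s hs)⟩
end

section
/- Suppose r ∈ convexHull(R) and b ∈ convexHull(B) realize the distance between the two convex hulls, i.e. dist(r, b) ≤ dist(x, y) for all x ∈ convexHull(R) and y ∈ convexHull(B), and r ≠ b. Then for every r' ∈ R, ⟪b − r, r'⟫ ≤ ⟪b − r, r⟫, and for every b' ∈ B, ⟪b − r, b'⟫ ≥ ⟪b − r, b⟫. Hence the strip {x : ⟪b − r, r⟫ ≤ ⟪b − r, x⟫ ≤ ⟪b − r, b⟫}, which is bounded by the two lines through r and b perpendicular to the segment from r to b and has width dist(r, b), separates R from B. -/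
open RealInnerProductSpace

/-- If `v` minimizes the distance from `u` to the convex set `K`, then the hyperplane through `v`
orthogonal to `u - v` supports `K`. -/
theorem Convex.inner_sub_le_of_forall_dist_le {F : Type*} [NormedAddCommGroup F]
    [InnerProductSpace ℝ F] {K : Set F} (hK : Convex ℝ K) {u v w : F} (hv : v ∈ K)
    (h : ∀ x ∈ K, dist u v ≤ dist u x) (hw : w ∈ K) :
    inner ℝ (u - v) w ≤ inner ℝ (u - v) v := by
  have : Nonempty K := ⟨⟨v, hv⟩⟩
  have hinf : ‖u - v‖ = ⨅ x : K, ‖u - x‖ := by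
    refine le_antisymm (le_ciInf fun x => ?_) ?_
    · simpa [dist_eq_norm] using h x x.2
    · exact ciInf_le (f := fun x : K => ‖u - x‖)
        ⟨0, Set.forall_mem_range.2 fun x => norm_nonneg _⟩ ⟨v, hv⟩
  have := (norm_eq_iInf_iff_real_inner_le_zero hK hv).1 hinf w hw
  rwa [inner_sub_right, sub_nonpos] at this

theorem stmt3 (R B : Finset (EuclideanSpace ℝ (Fin 2))) (hR : R.Nonempty) (hB : B.Nonempty)
    (r b : EuclideanSpace ℝ (Fin 2))
    (hr : r ∈ convexHull ℝ (R : Set (EuclideanSpace ℝ (Fin 2))))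
    (hb : b ∈ convexHull ℝ (B : Set (EuclideanSpace ℝ (Fin 2))))
    (hmin : ∀ x ∈ convexHull ℝ (R : Set (EuclideanSpace ℝ (Fin 2))),
      ∀ y ∈ convexHull ℝ (B : Set (EuclideanSpace ℝ (Fin 2))), dist r b ≤ dist x y)
    (hne : r ≠ b) :
    (∀ r' ∈ R, ⟪b - r, r'⟫ ≤ ⟪b - r, r⟫) ∧
    (∀ b' ∈ B, ⟪b - r, b⟫ ≤ ⟪b - r, b'⟫) ∧
    (⟪b - r, b⟫ - ⟪b - r, r⟫) / ‖b - r‖ = dist r b := by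
  refine ⟨fun r' hr' => ?_, fun b' hb' => ?_, ?_⟩
  · refine (convex_convexHull ℝ _).inner_sub_le_of_forall_dist_le hr (fun x hx => ?_)
      (subset_convexHull ℝ _ hr')
    simpa only [dist_comm b] using hmin x hx b hb
  · have h := (convex_convexHull ℝ _).inner_sub_le_of_forall_dist_le hb (hmin r hr)
      (subset_convexHull ℝ _ hb')
    rw [← neg_sub b r, inner_neg_left, inner_neg_left] at h
    exact neg_le_neg_iff.1 h
  · rw [← inner_sub_right, real_inner_self_eq_norm_mul_norm, dist_comm, dist_eq_norm,
      mul_div_cancel_right₀ _ (norm_ne_zero_iff.2 (sub_ne_zero.2 hne.symm))]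
end

section
/- Fix a slope m ∈ ℝ, and let c* = (A(m) + B'(m))/2. Then the line ℓ_{m,c*} minimizes Max among all lines of slope m: for every c ∈ ℝ, Max(ℓ_{m,c*}) ≤ Max(ℓ_{m,c}). (The optimal separator of slope m lies vertically midway between the extremal red point and the extremal blue point.) -/
open scoped Classical

/-- `MaxErr R B m c` is the maximum Euclidean distance from the line `y = m*x + c`
to a misclassified point: red points strictly above and blue points strictly below
the line, distance `|p₂ - (m*p₁ + c)| / √(1 + m²)`; it is `0` if no point is
misclassified. -/
noncomputable def MaxErr (R B : Finset (ℝ × ℝ)) (m c : ℝ) : ℝ :=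
  max ((R.filter (fun r => m * r.1 + c < r.2)).fold max 0
        (fun r => (r.2 - (m * r.1 + c)) / Real.sqrt (1 + m ^ 2)))
      ((B.filter (fun b => b.2 < m * b.1 + c)).fold max 0
        (fun b => ((m * b.1 + c) - b.2) / Real.sqrt (1 + m ^ 2)))

theorem maxErr_le_iff (R B : Finset (ℝ × ℝ)) (m c t : ℝ) :
    MaxErr R B m c ≤ t ↔ 0 ≤ t ∧
      (∀ r ∈ R, r.2 - m * r.1 - c ≤ t * Real.sqrt (1 + m ^ 2)) ∧
      ∀ b ∈ B, c - (b.2 - m * b.1) ≤ t * Real.sqrt (1 + m ^ 2) := by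
  have hs : 0 < Real.sqrt (1 + m ^ 2) := Real.sqrt_pos.2 (by positivity)
  simp only [MaxErr, max_le_iff, Finset.fold_max_le, Finset.mem_filter, and_imp, div_le_iff₀ hs]
  constructor
  · rintro ⟨⟨ht, hR⟩, -, hB⟩
    have hts : 0 ≤ t * Real.sqrt (1 + m ^ 2) := by positivity
    refine ⟨ht, fun r hr => ?_, fun b hb => ?_⟩
    · rcases lt_or_ge (m * r.1 + c) r.2 with h | h
      · linarith [hR r hr h]
      · linarith
    · rcases lt_or_ge b.2 (m * b.1 + c) with h | h
      · linarith [hB b hb h]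
      · linarith
  · rintro ⟨ht, hR, hB⟩
    exact ⟨⟨ht, fun r hr _ => by linarith [hR r hr]⟩, ht, fun b hb _ => by linarith [hB b hb]⟩

theorem stmt6 (R B : Finset (ℝ × ℝ)) (hR : R.Nonempty) (hB : B.Nonempty) (m : ℝ) :
    let A := R.sup' hR (fun r => r.2 - m * r.1)
    let B' := B.inf' hB (fun b => b.2 - m * b.1)
    let cstar := (A + B') / 2
    ∀ c : ℝ, MaxErr R B m cstar ≤ MaxErr R B m c := by
  intro A B' cstar c
  obtain ⟨ht, hr, hb⟩ := (maxErr_le_iff R B m c _).1 le_rfl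
  have hA : A ≤ MaxErr R B m c * Real.sqrt (1 + m ^ 2) + c :=
    Finset.sup'_le hR _ fun r h => by linarith [hr r h]
  have hB' : c - MaxErr R B m c * Real.sqrt (1 + m ^ 2) ≤ B' :=
    Finset.le_inf' hB _ fun b h => by linarith [hb b h]
  have hc : cstar = (A + B') / 2 := rfl
  refine (maxErr_le_iff R B m cstar _).2 ⟨ht, fun r h => ?_, fun b h => ?_⟩
  · have hrA : r.2 - m * r.1 ≤ A := Finset.le_sup' (fun r : ℝ × ℝ => r.2 - m * r.1) h
    linarith
  · have hbB : B' ≤ b.2 - m * b.1 := Finset.inf'_le (fun b : ℝ × ℝ => b.2 - m * b.1) h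
    linarith
end

section
/- For every line ℓ_{m,c}, the maximum vertical distance from ℓ_{m,c} to a misclassified point of R ∪ B (taken to be 0 if no point is misclassified) equals max(0, A(m) − c, c − B'(m)). In particular, a misclassified point realizing the maximum vertical distance is an extremal point: a red point maximizing r₂ − m·r₁ or a blue point minimizing b₂ − m·b₁. -/
open scoped Classical

/-- `MaxVert R B m c` is the maximum vertical distance from the line `y = m*x + c`
to a misclassified point of `R ∪ B` (red points strictly above, blue points strictly
below the line), taken to be `0` if no point is misclassified. -/
noncomputable def MaxVert (R B : Finset (ℝ × ℝ)) (m c : ℝ) : ℝ :=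
  max ((R.filter (fun r => m * r.1 + c < r.2)).fold max 0
        (fun r => r.2 - (m * r.1 + c)))
      ((B.filter (fun b => b.2 < m * b.1 + c)).fold max 0
        (fun b => (m * b.1 + c) - b.2))

theorem Finset.fold_max_filter_pos {α : Type*} (s : Finset α) (hs : s.Nonempty) (f : α → ℝ)
    (p : α → Prop) [DecidablePred p] (hp : ∀ x, p x ↔ 0 < f x) :
    (s.filter p).fold max 0 f = max 0 (s.sup' hs f) := by
  refine le_antisymm ?_ (max_le ?_ (Finset.sup'_le hs f fun x hx => ?_))
  · refine (Finset.fold_max_le _).2 ⟨le_max_left _ _, fun x hx => ?_⟩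
    exact (Finset.le_sup' f (Finset.mem_filter.1 hx).1).trans (le_max_right _ _)
  · exact (Finset.le_fold_max _).2 (Or.inl le_rfl)
  · by_cases h : 0 < f x
    · exact (Finset.le_fold_max _).2
        (Or.inr ⟨x, Finset.mem_filter.2 ⟨hx, (hp x).2 h⟩, le_rfl⟩)
    · exact (Finset.le_fold_max _).2 (Or.inl (not_lt.1 h))

theorem maxVert_eq (R B : Finset (ℝ × ℝ)) (hR : R.Nonempty) (hB : B.Nonempty) (m c : ℝ) :
    MaxVert R B m c = max 0 (max (R.sup' hR (fun r => r.2 - m * r.1) - c)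
      (c - B.inf' hB (fun b => b.2 - m * b.1))) := by
  have hred : R.sup' hR (fun r => r.2 - (m * r.1 + c)) =
      R.sup' hR (fun r => r.2 - m * r.1) - c := by
    refine le_antisymm (Finset.sup'_le _ _ fun r hr => ?_)
      (sub_le_iff_le_add.2 (Finset.sup'_le _ _ fun r hr => ?_))
    · linarith [Finset.le_sup' (fun r : ℝ × ℝ => r.2 - m * r.1) hr]
    · linarith [Finset.le_sup' (fun r : ℝ × ℝ => r.2 - (m * r.1 + c)) hr]
  have hblue : B.sup' hB (fun b => (m * b.1 + c) - b.2) =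
      c - B.inf' hB (fun b => b.2 - m * b.1) := by
    refine le_antisymm (Finset.sup'_le _ _ fun b hb => ?_)
      (sub_le_comm.1 (Finset.le_inf' _ _ fun b hb => ?_))
    · linarith [Finset.inf'_le (fun b : ℝ × ℝ => b.2 - m * b.1) hb]
    · linarith [Finset.le_sup' (fun b : ℝ × ℝ => (m * b.1 + c) - b.2) hb]
  rw [MaxVert, Finset.fold_max_filter_pos R hR _ _ fun r => sub_pos.symm,
    Finset.fold_max_filter_pos B hB _ _ fun b => sub_pos.symm, hred, hblue,
    max_max_max_comm, max_self]

theorem stmt8 (R B : Finset (ℝ × ℝ)) (hR : R.Nonempty) (hB : B.Nonempty) (m c : ℝ) :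
    let A := R.sup' hR (fun r => r.2 - m * r.1)
    let B' := B.inf' hB (fun b => b.2 - m * b.1)
    MaxVert R B m c = max 0 (max (A - c) (c - B')) ∧
    (0 < MaxVert R B m c →
      (∃ r ∈ R, m * r.1 + c < r.2 ∧ r.2 - (m * r.1 + c) = MaxVert R B m c ∧
        r.2 - m * r.1 = A) ∨
      (∃ b ∈ B, b.2 < m * b.1 + c ∧ (m * b.1 + c) - b.2 = MaxVert R B m c ∧
        b.2 - m * b.1 = B')) := by
  intro A B'
  have hmax : MaxVert R B m c = max 0 (max (A - c) (c - B')) := maxVert_eq R B hR hB m c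
  refine ⟨hmax, fun hpos => ?_⟩
  have hmax' : MaxVert R B m c = max (A - c) (c - B') := by
    rcases max_choice 0 (max (A - c) (c - B')) with h | h
    · exact absurd (hmax.trans h) hpos.ne'
    · exact hmax.trans h
  rcases max_choice (A - c) (c - B') with h | h
  · obtain ⟨r, hr, hrA⟩ := R.exists_mem_eq_sup' hR (fun r => r.2 - m * r.1)
    change A = r.2 - m * r.1 at hrA
    exact Or.inl ⟨r, hr, by linarith, by linarith, hrA.symm⟩
  · obtain ⟨b, hb, hbB⟩ := B.exists_mem_eq_inf' hB (fun b => b.2 - m * b.1)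
    change B' = b.2 - m * b.1 at hbB
    exact Or.inr ⟨b, hb, by linarith, by linarith, hbB.symm⟩
end

section
/- Let s = (s₁, s₂) ∈ V with Mis(s) ≤ k, let C be the connected component of V containing s, and suppose s is a lowest leftmost point of C: p₁ ≥ s₁ for every p = (p₁,p₂) ∈ C, and p₂ ≥ s₂ for every p ∈ C with p₁ = s₁. Then there exist r ∈ R and b ∈ B such that s lies on both dual lines, i.e. s₂ = r₁·s₁ − r₂ and s₂ = b₁·s₁ − b₂: the leftmost point of a bounded valid region is a red–blue intersection. -/
open scoped Classical

/-- `MisDual R B s` is the number of misclassifications of the dual point `s`: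
the number of red dual lines `y = r₁·x − r₂` strictly below `s` plus the number of
blue dual lines `y = b₁·x − b₂` strictly above `s`. -/
noncomputable def MisDual (R B : Finset (ℝ × ℝ)) (s : ℝ × ℝ) : ℕ :=
  (R.filter (fun r => r.1 * s.1 - r.2 < s.2)).card +
  (B.filter (fun b => s.2 < b.1 * s.1 - b.2)).card

open scoped Topology in
/-- If moving left from `s` along a line of slope `-m` keeps the number of misclassifications
from growing, then `s` is not leftmost in its valid region. -/
theorem exists_left_of_eventually_misDual_le {R B : Finset (ℝ × ℝ)} {k : ℕ} {s : ℝ × ℝ}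
    (hs : MisDual R B s ≤ k) (m : ℝ)
    (h : ∀ᶠ t in 𝓝 (0 : ℝ), 0 ≤ t →
      MisDual R B (s.1 - t, s.2 + m * t) ≤ MisDual R B s) :
    ∃ p ∈ connectedComponentIn {z : ℝ × ℝ | MisDual R B z ≤ k} s, p.1 < s.1 := by
  obtain ⟨ε, hε, hball⟩ := Metric.eventually_nhds_iff.1 h
  let f : ℝ → ℝ × ℝ := fun t => (s.1 - t, s.2 + m * t)
  have hf : Continuous f := by fun_prop
  have hpre : IsPreconnected (f '' Set.Icc 0 (ε / 2)) :=
    isPreconnected_Icc.image f hf.continuousOn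
  have hmem : s ∈ f '' Set.Icc 0 (ε / 2) :=
    ⟨0, ⟨le_rfl, by positivity⟩, by simp [f]⟩
  have hsub : f '' Set.Icc 0 (ε / 2) ⊆ {z : ℝ × ℝ | MisDual R B z ≤ k} := by
    rintro _ ⟨t, ⟨ht0, ht⟩, rfl⟩
    refine (hball ?_ ht0).trans hs
    rw [Real.dist_eq, sub_zero, abs_of_nonneg ht0]
    linarith
  refine ⟨f (ε / 2), hpre.subset_connectedComponentIn hmem hsub
    ⟨ε / 2, ⟨by positivity, le_rfl⟩, rfl⟩, ?_⟩
  change s.1 - ε / 2 < s.1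
  linarith

open scoped Topology in
/-- Dual lines that do not pass through `s` stay on the same side of a point moving along a short
segment from `s`. -/
theorem eventually_forall_side_iff_of_ne (B : Finset (ℝ × ℝ)) (s : ℝ × ℝ) (m : ℝ)
    (h : ∀ b ∈ B, s.2 ≠ b.1 * s.1 - b.2) :
    ∀ᶠ t in 𝓝 (0 : ℝ), ∀ b ∈ B,
      (s.2 + m * t < b.1 * (s.1 - t) - b.2 ↔ s.2 < b.1 * s.1 - b.2) ∧
      (b.1 * (s.1 - t) - b.2 < s.2 + m * t ↔ b.1 * s.1 - b.2 < s.2) := by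
  rw [Filter.eventually_all_finset]
  intro b hb
  have hl : Filter.Tendsto (fun t : ℝ => s.2 + m * t) (𝓝 0) (𝓝 s.2) := by
    have : Continuous fun t : ℝ => s.2 + m * t := by fun_prop
    simpa using this.tendsto 0
  have hr : Filter.Tendsto (fun t : ℝ => b.1 * (s.1 - t) - b.2) (𝓝 0)
      (𝓝 (b.1 * s.1 - b.2)) := by
    have : Continuous fun t : ℝ => b.1 * (s.1 - t) - b.2 := by fun_prop
    simpa using this.tendsto 0
  rcases lt_or_gt_of_ne (h b hb) with hlt | hlt
  · filter_upwards [hl.eventually_lt hr hlt] with t ht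
    exact ⟨iff_of_true ht hlt, iff_of_false ht.not_gt hlt.not_gt⟩
  · filter_upwards [hr.eventually_lt hl hlt] with t ht
    exact ⟨iff_of_false ht.not_gt hlt.not_gt, iff_of_true ht hlt⟩

theorem stmt13 (R B : Finset (ℝ × ℝ)) (k : ℕ)
    (hx : ∀ p ∈ R ∪ B, ∀ q ∈ R ∪ B, p ≠ q → p.1 ≠ q.1)
    (hcol : ∀ p ∈ R ∪ B, ∀ q ∈ R ∪ B, ∀ w ∈ R ∪ B,
      p ≠ q → q ≠ w → p ≠ w → ¬ Collinear ℝ ({p, q, w} : Set (ℝ × ℝ)))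
    (s : ℝ × ℝ) (hs : MisDual R B s ≤ k)
    (hleft : ∀ p ∈ connectedComponentIn {z : ℝ × ℝ | MisDual R B z ≤ k} s, s.1 ≤ p.1)
    (hlow : ∀ p ∈ connectedComponentIn {z : ℝ × ℝ | MisDual R B z ≤ k} s,
      p.1 = s.1 → s.2 ≤ p.2) :
    (∃ r ∈ R, s.2 = r.1 * s.1 - r.2) ∧ (∃ b ∈ B, s.2 = b.1 * s.1 - b.2) := by
  constructor
  · by_contra! hR
    obtain ⟨M, hM⟩ := (B.image fun b => -b.1).bddAbove
    obtain ⟨p, hp, hlt⟩ := exists_left_of_eventually_misDual_le hs M (by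
      filter_upwards [eventually_forall_side_iff_of_ne R s M hR] with t ht ht0
      refine add_le_add (Finset.card_le_card fun r hr => ?_) (Finset.card_le_card fun b hb => ?_)
      · rw [Finset.mem_filter] at hr ⊢
        exact ⟨hr.1, (ht r hr.1).2.1 hr.2⟩
      · rw [Finset.mem_filter] at hb ⊢
        have hb' : -b.1 ≤ M := hM (Finset.mem_coe.2 (Finset.mem_image_of_mem _ hb.1))
        have hb2 : s.2 + M * t < b.1 * (s.1 - t) - b.2 := hb.2
        exact ⟨hb.1, by nlinarith [mul_le_mul_of_nonneg_right hb' ht0]⟩)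
    exact (hleft p hp).not_gt hlt
  · by_contra! hB
    obtain ⟨m, hm⟩ := (R.image fun r => -r.1).bddBelow
    obtain ⟨p, hp, hlt⟩ := exists_left_of_eventually_misDual_le hs m (by
      filter_upwards [eventually_forall_side_iff_of_ne B s m hB] with t ht ht0
      refine add_le_add (Finset.card_le_card fun r hr => ?_) (Finset.card_le_card fun b hb => ?_)
      · rw [Finset.mem_filter] at hr ⊢
        have hr' : m ≤ -r.1 := hm (Finset.mem_coe.2 (Finset.mem_image_of_mem _ hr.1))
        have hr2 : r.1 * (s.1 - t) - r.2 < s.2 + m * t := hr.2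
        exact ⟨hr.1, by nlinarith [mul_le_mul_of_nonneg_right hr' ht0]⟩
      · rw [Finset.mem_filter] at hb ⊢
        exact ⟨hb.1, (ht b hb.1).1.1 hb.2⟩)
    exact (hleft p hp).not_gt hlt
end
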